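/- Let m be a positive integer and let f_i : I_i → ℝ (1 ≤ i ≤ n) be smooth on open intervals with f_i' nowhere zero. On I_1 × ⋯ × I_n set A = 1 + Σ_{i=1}^n (f_i'(u_i))^{2m/(2m-1)}, η = A^{-1/(2m)}(−(f_1'(u_1))^{1/(2m-1)}, …, −(f_n'(u_n))^{1/(2m-1)}, 1), and X_{u_k} = e_k + f_k'(u_k) e_{n+1} ∈ ℝ^{n+1}. Then for each j, ∂η/∂u_j = Σ_{k=1}^n η_j^k X_{u_k}, where η_j^j = −(A^{-(2m+1)/(2m)}/(2m-1)) (f_j')^{-(2m-2)/(2m-1)} f_j'' (1 + Σ_{i≠j} (f_i')^{2m/(2m-1)}) and, for k ≠ j, η_j^k = (A^{-(2m+1)/(2m)}/(2m-1)) (f_j')^{1/(2m-1)} f_j'' (f_k')^{1/(2m-1)}. Consequently (1/n) Σ_{j=1}^n η_j^j = −(A^{-(2m+1)/(2m)}/(n(2m-1))) Σ_{j=1}^n [(f_j')^{-(2m-2)/(2m-1)} f_j'' (1 + Σ_{i≠j} (f_i')^{2m/(2m-1)})]. -/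

import Mathlib

/-- The real `(2m-1)`-th root of `y`: the unique real number `s` with `s^(2m-1) = y`.
For `y ≠ 0`, the fractional power `y^(p/(2m-1))` is interpreted as `(oddRoot m y)^p`. -/
noncomputable def oddRoot (m : ℕ) (y : ℝ) : ℝ :=
  Real.sign y * |y| ^ ((2 * (m : ℝ) - 1)⁻¹)

/-- `A = 1 + Σᵢ (fᵢ'(uᵢ))^{2m/(2m-1)}` for a translation hypersurface. -/
noncomputable def Atr (m n : ℕ) (f : Fin n → ℝ → ℝ) (u : Fin n → ℝ) : ℝ :=
  1 + ∑ i, (oddRoot m (deriv (f i) (u i))) ^ (2 * m)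

/-- The Birkhoff–Gauss map of the translation hypersurface
`x_{n+1} = f₁(u₁)+⋯+f_n(u_n)`. -/
noncomputable def etaTr (m n : ℕ) (f : Fin n → ℝ → ℝ) (u : Fin n → ℝ) :
    Fin (n + 1) → ℝ :=
  fun i => (Atr m n f u) ^ (-(1 : ℝ) / (2 * (m : ℝ)))
    * (Fin.snoc (fun k : Fin n => -(oddRoot m (deriv (f k) (u k)))) 1 :
        Fin (n + 1) → ℝ) i

/-- The tangent vector `X_{u_k} = e_k + f_k'(u_k) e_{n+1}`. -/
noncomputable def Xtr (n : ℕ) (f : Fin n → ℝ → ℝ) (u : Fin n → ℝ) (k : Fin n) :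
    Fin (n + 1) → ℝ :=
  (Fin.snoc (Pi.single k 1) (deriv (f k) (u k)) : Fin (n + 1) → ℝ)

/-- The coefficients `η_j^k` in `∂η/∂u_j = Σ_k η_j^k X_{u_k}`. -/
noncomputable def etaCoef (m n : ℕ) (f : Fin n → ℝ → ℝ) (u : Fin n → ℝ)
    (j k : Fin n) : ℝ :=
  if k = j then
    -((Atr m n f u) ^ (-(2 * (m : ℝ) + 1) / (2 * (m : ℝ))) / (2 * (m : ℝ) - 1))
      * ((oddRoot m (deriv (f j) (u j))) ^ (2 * m - 2))⁻¹
      * deriv (deriv (f j)) (u j)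
      * (1 + ∑ i ∈ Finset.univ.erase j, (oddRoot m (deriv (f i) (u i))) ^ (2 * m))
  else
    ((Atr m n f u) ^ (-(2 * (m : ℝ) + 1) / (2 * (m : ℝ))) / (2 * (m : ℝ) - 1))
      * (oddRoot m (deriv (f j) (u j))) * deriv (deriv (f j)) (u j)
      * (oddRoot m (deriv (f k) (u k)))

theorem oddRoot_neg (m : ℕ) (y : ℝ) : oddRoot m (-y) = -oddRoot m y := by
  simp [oddRoot, Real.sign_neg]

theorem oddRoot_of_pos (m : ℕ) {y : ℝ} (hy : 0 < y) :
    oddRoot m y = y ^ ((2 * (m : ℝ) - 1)⁻¹) := by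
  simp [oddRoot, Real.sign_of_pos hy, abs_of_pos hy]

theorem two_mul_natCast_sub_one_pos {m : ℕ} (hm : 1 ≤ m) : 0 < 2 * (m : ℝ) - 1 := by
  have : (1 : ℝ) ≤ m := by exact_mod_cast hm
  linarith

theorem oddRoot_pow {m : ℕ} (hm : 1 ≤ m) {y : ℝ} (hy : y ≠ 0) :
    oddRoot m y ^ (2 * m - 1) = y := by
  have hc : (((2 * m - 1 : ℕ) : ℝ)) = 2 * (m : ℝ) - 1 := by
    rw [Nat.cast_sub (by omega)]; push_cast; ring
  have key : ∀ z : ℝ, 0 < z → oddRoot m z ^ (2 * m - 1) = z := fun z hz => by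
    rw [oddRoot_of_pos m hz, ← hc]
    exact Real.rpow_inv_natCast_pow hz.le (by omega)
  rcases hy.lt_or_gt with h | h
  · have hodd : Odd (2 * m - 1) := ⟨m - 1, by omega⟩
    have := key (-y) (by linarith)
    rw [oddRoot_neg, hodd.neg_pow] at this
    linarith
  · exact key y h

theorem oddRoot_ne_zero {m : ℕ} (hm : 1 ≤ m) {y : ℝ} (hy : y ≠ 0) : oddRoot m y ≠ 0 := by
  intro h
  apply hy
  rw [← oddRoot_pow hm hy, h, zero_pow (by omega)]

theorem hasDerivAt_oddRoot {m : ℕ} (hm : 1 ≤ m) {y : ℝ} (hy : y ≠ 0) :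
    HasDerivAt (oddRoot m) ((2 * (m : ℝ) - 1)⁻¹ * (oddRoot m y ^ (2 * m - 2))⁻¹) y := by
  have hpos := two_mul_natCast_sub_one_pos hm
  have key : ∀ z : ℝ, 0 < z →
      HasDerivAt (oddRoot m) ((2 * (m : ℝ) - 1)⁻¹ * (oddRoot m z ^ (2 * m - 2))⁻¹) z := by
    intro z hz
    have h := Real.hasDerivAt_rpow_const (x := z) (p := (2 * (m : ℝ) - 1)⁻¹) (Or.inl hz.ne')
    have heq : oddRoot m =ᶠ[nhds z] fun x => x ^ ((2 * (m : ℝ) - 1)⁻¹) := by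
      filter_upwards [lt_mem_nhds hz] with x hx using oddRoot_of_pos m hx
    refine (h.congr_of_eventuallyEq heq).congr_deriv ?_
    rw [oddRoot_of_pos m hz, ← Real.rpow_natCast, ← Real.rpow_mul hz.le, ← Real.rpow_neg hz.le]
    congr 2
    rw [Nat.cast_sub (by omega)]
    push_cast
    field_simp
    ring
  rcases hy.lt_or_gt with h | h
  · have heq : oddRoot m = fun x => -oddRoot m (-x) := by
      funext x; rw [oddRoot_neg, neg_neg]
    have heven : Even (2 * m - 2) := ⟨m - 1, by omega⟩
    have hd := ((key (-y) (by linarith)).comp y (hasDerivAt_neg y)).neg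
    rw [oddRoot_neg, heven.neg_pow] at hd
    rw [heq]
    exact hd.congr_deriv (by simp [oddRoot_neg])
  · exact key y h

theorem Atr_pos (m n : ℕ) (f : Fin n → ℝ → ℝ) (u : Fin n → ℝ) : 0 < Atr m n f u := by
  have : 0 ≤ ∑ i, (oddRoot m (deriv (f i) (u i))) ^ (2 * m) :=
    Finset.sum_nonneg fun i _ => (even_two_mul m).pow_nonneg _
  unfold Atr
  linarith

theorem Atr_eq_erase (m n : ℕ) (f : Fin n → ℝ → ℝ) (u : Fin n → ℝ) (j : Fin n) :
    1 + ∑ i ∈ Finset.univ.erase j, (oddRoot m (deriv (f i) (u i))) ^ (2 * m)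
      = Atr m n f u - oddRoot m (deriv (f j) (u j)) ^ (2 * m) := by
  rw [Atr, ← Finset.add_sum_erase _ _ (Finset.mem_univ j)]
  ring

section PartialDerivatives

variable {m n : ℕ} {f : Fin n → ℝ → ℝ} {u : Fin n → ℝ}

theorem hasFDerivAt_oddRoot_deriv (hm : 1 ≤ m) (k : Fin n)
    (hd : DifferentiableAt ℝ (deriv (f k)) (u k)) (h0 : deriv (f k) (u k) ≠ 0) :
    HasFDerivAt (fun v : Fin n → ℝ => oddRoot m (deriv (f k) (v k)))
      (((2 * (m : ℝ) - 1)⁻¹ * (oddRoot m (deriv (f k) (u k)) ^ (2 * m - 2))⁻¹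
        * deriv (deriv (f k)) (u k)) • ContinuousLinearMap.proj (R := ℝ) k) u := by
  have h := (hasDerivAt_oddRoot hm h0).comp (u k) hd.hasDerivAt
  have hp : HasFDerivAt (fun v : Fin n → ℝ => v k) (ContinuousLinearMap.proj (R := ℝ) k) u :=
    hasFDerivAt_apply k u
  exact h.comp_hasFDerivAt u hp

/-- The scalar factor of the Birkhoff–Gauss map and its partial derivatives. -/
theorem exists_hasFDerivAt_Atr_rpow (hm : 1 ≤ m)
    (hd : ∀ k, DifferentiableAt ℝ (deriv (f k)) (u k)) (h0 : ∀ k, deriv (f k) (u k) ≠ 0) :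
    ∃ L : (Fin n → ℝ) →L[ℝ] ℝ,
      HasFDerivAt (fun v => Atr m n f v ^ (-(1 : ℝ) / (2 * (m : ℝ)))) L u ∧
      ∀ j, L (Pi.single j 1) =
        -(Atr m n f u ^ (-(2 * (m : ℝ) + 1) / (2 * (m : ℝ))) / (2 * (m : ℝ) - 1)
          * oddRoot m (deriv (f j) (u j)) * deriv (deriv (f j)) (u j)) := by
  have hA : HasFDerivAt (Atr m n f) _ u :=
    (HasFDerivAt.fun_sum fun k (_ : k ∈ Finset.univ) =>
      (hasFDerivAt_oddRoot_deriv hm k (hd k) (h0 k)).pow (2 * m)).const_add 1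
  refine ⟨_, hA.rpow_const (Or.inl (Atr_pos m n f u).ne'), fun j => ?_⟩
  have hm0 : (m : ℝ) ≠ 0 := by exact_mod_cast (by omega : m ≠ 0)
  have hpos := (two_mul_natCast_sub_one_pos hm).ne'
  have hs := oddRoot_ne_zero hm (h0 j)
  have hexp : -(1 : ℝ) / (2 * (m : ℝ)) - 1 = -(2 * (m : ℝ) + 1) / (2 * (m : ℝ)) := by
    field_simp; ring
  have hpow : oddRoot m (deriv (f j) (u j)) ^ (2 * m - 1)
      = oddRoot m (deriv (f j) (u j)) ^ (2 * m - 2) * oddRoot m (deriv (f j) (u j)) := by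
    rw [← pow_succ]; congr 1; omega
  rw [hexp]
  simp [Pi.single_apply, hpow]
  field_simp

end PartialDerivatives

theorem sum_etaCoef_smul_Xtr_castSucc (m n : ℕ) (f : Fin n → ℝ → ℝ) (u : Fin n → ℝ)
    (j i : Fin n) :
    (∑ k, etaCoef m n f u j k • Xtr n f u k) i.castSucc = etaCoef m n f u j i := by
  simp [Finset.sum_apply, Xtr, Pi.single_apply]

theorem sum_etaCoef_smul_Xtr_last {m n : ℕ} (hm : 1 ≤ m) (f : Fin n → ℝ → ℝ) (u : Fin n → ℝ)
    (h0 : ∀ k, deriv (f k) (u k) ≠ 0) (j : Fin n) :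
    (∑ k, etaCoef m n f u j k • Xtr n f u k) (Fin.last n) =
      -(Atr m n f u ^ (-(2 * (m : ℝ) + 1) / (2 * (m : ℝ))) / (2 * (m : ℝ) - 1)
          * oddRoot m (deriv (f j) (u j)) * deriv (deriv (f j)) (u j)) := by
  have hpow : ∀ k, oddRoot m (deriv (f k) (u k)) * deriv (f k) (u k)
      = oddRoot m (deriv (f k) (u k)) ^ (2 * m) := fun k => by
    nth_rw 2 [← oddRoot_pow hm (h0 k)]
    rw [← pow_succ', show 2 * m - 1 + 1 = 2 * m by omega]
  have hs := oddRoot_ne_zero hm (h0 j)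
  have hj : (oddRoot m (deriv (f j) (u j)) ^ (2 * m - 2))⁻¹ * deriv (f j) (u j)
      = oddRoot m (deriv (f j) (u j)) := by
    rw [inv_mul_eq_iff_eq_mul₀ (pow_ne_zero _ hs), ← pow_succ]
    rw [show 2 * m - 2 + 1 = 2 * m - 1 by omega, oddRoot_pow hm (h0 j)]
  have hrest : ∑ k ∈ Finset.univ.erase j, etaCoef m n f u j k * deriv (f k) (u k)
      = Atr m n f u ^ (-(2 * (m : ℝ) + 1) / (2 * (m : ℝ))) / (2 * (m : ℝ) - 1)
          * oddRoot m (deriv (f j) (u j)) * deriv (deriv (f j)) (u j)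
        * ∑ k ∈ Finset.univ.erase j, oddRoot m (deriv (f k) (u k)) ^ (2 * m) := by
    rw [Finset.mul_sum]
    refine Finset.sum_congr rfl fun k hk => ?_
    rw [etaCoef, if_neg (Finset.ne_of_mem_erase hk), mul_assoc, hpow]
  simp only [Finset.sum_apply, Pi.smul_apply, Xtr, Fin.snoc_last, smul_eq_mul]
  rw [← Finset.add_sum_erase _ _ (Finset.mem_univ j), hrest, etaCoef, if_pos rfl]
  linear_combination (-(Atr m n f u ^ (-(2 * (m : ℝ) + 1) / (2 * (m : ℝ))) / (2 * (m : ℝ) - 1))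
    * deriv (deriv (f j)) (u j)
    * (1 + ∑ i ∈ Finset.univ.erase j, (oddRoot m (deriv (f i) (u i))) ^ (2 * m))) * hj

/-- for a translation hypersurface, `∂η/∂u_j = Σ_k η_j^k X_{u_k}`
with the coefficients `η_j^k` above, and consequently the mean curvature
`(1/n) Σ_j η_j^j` equals formula (3.1). -/
theorem etaTr_deriv_and_mean_curvature (m n : ℕ) (hm : 1 ≤ m)
    (a b : Fin n → ℝ) (f : Fin n → ℝ → ℝ)
    (hf : ∀ i, ContDiffOn ℝ (⊤ : ℕ∞) (f i) (Set.Ioo (a i) (b i)))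
    (hf1 : ∀ i, ∀ t ∈ Set.Ioo (a i) (b i), deriv (f i) t ≠ 0) :
    ∀ u : Fin n → ℝ, (∀ i, u i ∈ Set.Ioo (a i) (b i)) →
      (∀ j : Fin n,
        fderiv ℝ (etaTr m n f) u (Pi.single j 1)
          = ∑ k, etaCoef m n f u j k • Xtr n f u k) ∧
      (1 / (n : ℝ)) * ∑ j, etaCoef m n f u j j
        = -((Atr m n f u) ^ (-(2 * (m : ℝ) + 1) / (2 * (m : ℝ)))
              / ((n : ℝ) * (2 * (m : ℝ) - 1)))
          * ∑ j, ((oddRoot m (deriv (f j) (u j))) ^ (2 * m - 2))⁻¹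
              * deriv (deriv (f j)) (u j)
              * (1 + ∑ i ∈ Finset.univ.erase j,
                  (oddRoot m (deriv (f i) (u i))) ^ (2 * m)) := by
  intro u hu
  have h0 : ∀ k, deriv (f k) (u k) ≠ 0 := fun k => hf1 k _ (hu k)
  have hd : ∀ k, DifferentiableAt ℝ (deriv (f k)) (u k) := fun k =>
    (((hf k).deriv_of_isOpen isOpen_Ioo (m := 1) (WithTop.coe_le_coe.2 le_top)).differentiableOn
      one_ne_zero).differentiableAt (isOpen_Ioo.mem_nhds (hu k))
  have hpos := (two_mul_natCast_sub_one_pos hm).ne'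
  refine ⟨fun j => ?_, ?_⟩
  · obtain ⟨L, hL, hLj⟩ := exists_hasFDerivAt_Atr_rpow hm hd h0
    have hcast : ∀ i : Fin n, HasFDerivAt (fun v => etaTr m n f v i.castSucc) _ u := fun i => by
      simp only [etaTr, Fin.snoc_castSucc]
      exact hL.mul (hasFDerivAt_oddRoot_deriv hm i (hd i) (h0 i)).fun_neg
    have hlast : HasFDerivAt (fun v => etaTr m n f v (Fin.last n)) L u := by
      simpa only [etaTr, Fin.snoc_last, mul_one] using hL
    have hdiff : ∀ i, DifferentiableAt ℝ (fun v => etaTr m n f v i) u := fun i =>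
      Fin.lastCases hlast.differentiableAt (fun i => (hcast i).differentiableAt) i
    have happ : ∀ i, fderiv ℝ (etaTr m n f) u (Pi.single j 1) i
        = fderiv ℝ (fun v => etaTr m n f v i) u (Pi.single j 1) := fun i => by
      rw [fderiv_apply (differentiableAt_pi.2 hdiff)]
      rfl
    funext i
    rw [happ]
    refine Fin.lastCases ?_ (fun i => ?_) i
    · rw [hlast.fderiv, hLj, sum_etaCoef_smul_Xtr_last hm f u h0]
    · rw [(hcast i).fderiv, sum_etaCoef_smul_Xtr_castSucc]
      by_cases hij : i = j
      · subst hij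
        have hs := oddRoot_ne_zero hm (h0 i)
        have hA := (Atr_pos m n f u)
        have hm0 : (m : ℝ) ≠ 0 := by exact_mod_cast (by omega : m ≠ 0)
        have hexp : Atr m n f u ^ (-(1 : ℝ) / (2 * (m : ℝ)))
            = Atr m n f u ^ (-(2 * (m : ℝ) + 1) / (2 * (m : ℝ))) * Atr m n f u := by
          rw [← Real.rpow_add_one hA.ne']
          congr 1
          field_simp
          ring
        have hpow : oddRoot m (deriv (f i) (u i)) ^ (2 * m)
            = oddRoot m (deriv (f i) (u i)) ^ (2 * m - 2) * oddRoot m (deriv (f i) (u i)) ^ 2 := by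
          rw [← pow_add]; congr 1; omega
        rw [etaCoef, if_pos rfl, Atr_eq_erase, hpow]
        simp only [add_apply, smul_apply, neg_apply, ContinuousLinearMap.proj_apply,
          Pi.single_eq_same, smul_eq_mul, hLj, hexp]
        generalize Atr m n f u ^ (-(2 * (m : ℝ) + 1) / (2 * (m : ℝ))) = c
        field_simp
        ring
      · rw [etaCoef, if_neg hij]
        simp [hLj, hij]
        ring
  · simp only [etaCoef, if_true, Finset.mul_sum]
    refine Finset.sum_congr rfl fun j _ => ?_
    generalize 2 * (m : ℝ) - 1 = d
    ring
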